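/- Let u : Ω → ℝ be a C² function on an open set Ω ⊂ ℝ² with u_{x}² + u_{y}² < 1, whose graph is a maximal surface, i.e. (1−u_x²)u_{yy} + 2 u_x u_y u_{xy} + (1−u_y²)u_{xx} = 0. If v is another such solution on Ω with u ≥ v on Ω and u(p) = v(p) at some interior point p, then u = v on the connected component of Ω containing p. -/

import Mathlib

/-- Partial derivative in the first variable of a function on `ℝ × ℝ`. -/
noncomputable def pdx (u : ℝ × ℝ → ℝ) (p : ℝ × ℝ) : ℝ := fderiv ℝ u p (1, 0)

/-- Partial derivative in the second variable of a function on `ℝ × ℝ`. -/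
noncomputable def pdy (u : ℝ × ℝ → ℝ) (p : ℝ × ℝ) : ℝ := fderiv ℝ u p (0, 1)

open Filter Topology

/-- Second derivative as a bilinear expression. -/
noncomputable def hess (f : ℝ × ℝ → ℝ) (y d e : ℝ × ℝ) : ℝ := fderiv ℝ (fderiv ℝ f) y d e

theorem diffAt_fderiv {f : ℝ × ℝ → ℝ} {y : ℝ × ℝ} (hf : ContDiffAt ℝ 2 f y) :
    DifferentiableAt ℝ (fderiv ℝ f) y :=
  (hf.fderiv_right (m := 1) (by norm_num)).differentiableAt (by norm_num)

theorem fderiv_dir {f : ℝ × ℝ → ℝ} {y : ℝ × ℝ} (hf : ContDiffAt ℝ 2 f y) (d e : ℝ × ℝ) :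
    fderiv ℝ (fun p => fderiv ℝ f p e) y d = hess f y d e := by
  rw [fderiv_clm_apply (diffAt_fderiv hf) (differentiableAt_const e)]
  simp [hess]

theorem ev_diff {f : ℝ × ℝ → ℝ} {y : ℝ × ℝ} (hf : ContDiffAt ℝ 2 f y) :
    ∀ᶠ x in 𝓝 y, DifferentiableAt ℝ f x := by
  filter_upwards [hf.eventually (by norm_num)] with x hx
  exact hx.differentiableAt (by norm_num)

theorem hess_sub {f g : ℝ × ℝ → ℝ} {y : ℝ × ℝ} (hf : ContDiffAt ℝ 2 f y)
    (hg : ContDiffAt ℝ 2 g y) (d e : ℝ × ℝ) :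
    hess (fun x => f x - g x) y d e = hess f y d e - hess g y d e := by
  have h : fderiv ℝ (fun x => f x - g x) =ᶠ[𝓝 y] fun x => fderiv ℝ f x - fderiv ℝ g x := by
    filter_upwards [ev_diff hf, ev_diff hg] with x h1 h2
    exact fderiv_fun_sub h1 h2
  unfold hess
  rw [h.fderiv_eq, fderiv_fun_sub (diffAt_fderiv hf) (diffAt_fderiv hg)]
  simp

theorem hess_symm {f : ℝ × ℝ → ℝ} {y : ℝ × ℝ} (hf : ContDiffAt ℝ 2 f y) (d e : ℝ × ℝ) :
    hess f y d e = hess f y e d :=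
  (hf.isSymmSndFDerivAt (by simp)) d e

theorem hess_expand {f : ℝ × ℝ → ℝ} {y : ℝ × ℝ} (hf : ContDiffAt ℝ 2 f y) (s t : ℝ) :
    hess f y (s, t) (s, t) = s ^ 2 * hess f y (1, 0) (1, 0) + 2 * s * t * hess f y (0, 1) (1, 0)
      + t ^ 2 * hess f y (0, 1) (0, 1) := by
  have h : ((s, t) : ℝ × ℝ) = s • (1, 0) + t • (0, 1) := by simp
  have h2 := hess_symm hf (1, 0) (0, 1)
  unfold hess at *
  rw [h]
  simp only [map_add, map_smul, add_apply, smul_apply, smul_eq_mul,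
    h2]
  ring

theorem hess_cont {f : ℝ × ℝ → ℝ} {y : ℝ × ℝ} (hf : ContDiffAt ℝ 2 f y) (d e : ℝ × ℝ) :
    ContinuousAt (fun x => hess f x d e) y := by
  have h1 : ContDiffAt ℝ 1 (fderiv ℝ f) y := hf.fderiv_right (by norm_num)
  have h2 : ContDiffAt ℝ 0 (fderiv ℝ (fderiv ℝ f)) y := h1.fderiv_right (by norm_num)
  exact (h2.continuousAt.clm_apply continuousAt_const).clm_apply continuousAt_const

theorem hess_nonneg {f : ℝ × ℝ → ℝ} {y : ℝ × ℝ} (hf : ContDiffAt ℝ 2 f y)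
    (hm : IsLocalMin f y) (d : ℝ × ℝ) : 0 ≤ hess f y d d := by
  set l : ℝ → ℝ × ℝ := fun t => y + t • d with hl
  have hl0 : l 0 = y := by simp [hl]
  have hld : ∀ t, HasDerivAt l d t := fun t => by
    have h := ((hasDerivAt_id t).smul_const d).const_add y
    rw [one_smul] at h
    exact h
  have hlc : Tendsto l (𝓝 0) (𝓝 y) := by
    have := (hld 0).continuousAt.tendsto
    rwa [hl0] at this
  have hd1 : deriv (f ∘ l) =ᶠ[𝓝 0] fun t => fderiv ℝ f (l t) d := by
    filter_upwards [hlc.eventually (ev_diff hf)] with t ht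
    exact (ht.hasFDerivAt.comp_hasDerivAt t (hld t)).deriv
  have hd2 : deriv (deriv (f ∘ l)) 0 = hess f y d d := by
    rw [hd1.deriv_eq]
    have h1 : HasFDerivAt (fderiv ℝ f) (fderiv ℝ (fderiv ℝ f) y) (l 0) := by
      rw [hl0]; exact (diffAt_fderiv hf).hasFDerivAt
    have h2 := h1.comp_hasDerivAt 0 (hld 0)
    have h3 := h2.clm_apply (hasDerivAt_const (0 : ℝ) d)
    have h4 := h3.deriv
    simpa [hess, Function.comp_def] using h4
  have hmin : IsLocalMin (f ∘ l) 0 := by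
    have := hlc.eventually hm
    simpa [IsLocalMin, IsMinFilter, hl0] using this
  by_contra hneg
  push Not at hneg
  have hmax : IsLocalMax (f ∘ l) 0 := by
    apply isLocalMax_of_deriv_deriv_neg (by rw [hd2]; exact hneg) hmin.deriv_eq_zero
    have : ContinuousAt f (l 0) := by rw [hl0]; exact hf.continuousAt
    exact this.comp (hld 0).continuousAt
  have hc : f ∘ l =ᶠ[𝓝 0] fun _ => (f ∘ l) 0 := by
    filter_upwards [hmin, hmax] with t h1 h2
    exact le_antisymm h2 h1
  have h0 : deriv (deriv (f ∘ l)) 0 = 0 := by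
    rw [hc.deriv.deriv_eq]; simp
  rw [hd2] at h0
  linarith

/-- Barrier function. -/
noncomputable def bar (ε α k : ℝ) (q : ℝ × ℝ) (x : ℝ × ℝ) : ℝ :=
  ε * (Real.exp (-α * ((x.1 - q.1) ^ 2 + (x.2 - q.2) ^ 2)) - k)

theorem bar_contDiff (ε α k : ℝ) (q : ℝ × ℝ) : ContDiff ℝ 2 (bar ε α k q) := by
  unfold bar
  fun_prop

theorem exp_hasFDerivAt (α : ℝ) (q x : ℝ × ℝ) :
    HasFDerivAt (fun x : ℝ × ℝ => Real.exp (-α * ((x.1 - q.1) ^ 2 + (x.2 - q.2) ^ 2)))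
      ((Real.exp (-α * ((x.1 - q.1) ^ 2 + (x.2 - q.2) ^ 2)) * (-2 * α)) •
        ((x.1 - q.1) • ContinuousLinearMap.fst ℝ ℝ ℝ +
         (x.2 - q.2) • ContinuousLinearMap.snd ℝ ℝ ℝ)) x := by
  have h1 : HasFDerivAt (fun x : ℝ × ℝ => x.1) (ContinuousLinearMap.fst ℝ ℝ ℝ) x := hasFDerivAt_fst
  have h2 : HasFDerivAt (fun x : ℝ × ℝ => x.2) (ContinuousLinearMap.snd ℝ ℝ ℝ) x := hasFDerivAt_snd
  have h := ((((h1.sub_const q.1).pow 2).add ((h2.sub_const q.2).pow 2)).const_mul (-α)).exp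
  refine h.congr_fderiv ?_
  ext <;> simp <;> ring

theorem bar_fderiv (ε α k : ℝ) (q x d : ℝ × ℝ) :
    fderiv ℝ (bar ε α k q) x d =
      ε * (Real.exp (-α * ((x.1 - q.1) ^ 2 + (x.2 - q.2) ^ 2)) * (-2 * α)) *
        ((x.1 - q.1) * d.1 + (x.2 - q.2) * d.2) := by
  have h := ((exp_hasFDerivAt α q x).sub_const k).const_mul ε
  have : fderiv ℝ (bar ε α k q) x = _ := h.fderiv
  rw [this]
  simp
  ring

theorem bar_hess (ε α k : ℝ) (q x d e : ℝ × ℝ) :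
    hess (bar ε α k q) x d e =
      ε * Real.exp (-α * ((x.1 - q.1) ^ 2 + (x.2 - q.2) ^ 2)) *
        (4 * α ^ 2 * ((x.1 - q.1) * d.1 + (x.2 - q.2) * d.2)
          * ((x.1 - q.1) * e.1 + (x.2 - q.2) * e.2) - 2 * α * (d.1 * e.1 + d.2 * e.2)) := by
  rw [← fderiv_dir (bar_contDiff ε α k q).contDiffAt]
  have h0 : (fun p => fderiv ℝ (bar ε α k q) p e) = fun x : ℝ × ℝ =>
      ε * (Real.exp (-α * ((x.1 - q.1) ^ 2 + (x.2 - q.2) ^ 2)) * (-2 * α)) *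
        ((x.1 - q.1) * e.1 + (x.2 - q.2) * e.2) := by
    funext x; exact bar_fderiv ε α k q x e
  have h1 : HasFDerivAt (fun x : ℝ × ℝ => x.1) (ContinuousLinearMap.fst ℝ ℝ ℝ) x := hasFDerivAt_fst
  have h2 : HasFDerivAt (fun x : ℝ × ℝ => x.2) (ContinuousLinearMap.snd ℝ ℝ ℝ) x := hasFDerivAt_snd
  have h3 := (((h1.sub_const q.1).mul_const e.1).add ((h2.sub_const q.2).mul_const e.2))
  have h4 := (((exp_hasFDerivAt α q x).mul_const (-2 * α)).const_mul ε).mul h3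
  have h5 := h4.fderiv
  rw [h0]
  refine (congrArg (fun L : ℝ × ℝ →L[ℝ] ℝ => L d) h5).trans ?_
  simp
  ring

theorem abs_le_one_of_sq {a b : ℝ} (h : a ^ 2 + b ^ 2 < 1) : |a| ≤ 1 ∧ |b| ≤ 1 := by
  constructor
  · rw [← sq_le_one_iff_abs_le_one]; nlinarith [sq_nonneg b]
  · rw [← sq_le_one_iff_abs_le_one]; nlinarith [sq_nonneg a]

theorem bracket_bound {a b c h k M : ℝ} (ha : |a| ≤ 1) (hb : |b| ≤ 1) (hc : |c| ≤ 1)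
    (hh : |h| ≤ M) (hk : |k| ≤ M) : |(a + b) * h - 2 * c * k| ≤ 4 * M := by
  have hM : 0 ≤ M := (abs_nonneg h).trans hh
  have h1 : |(a + b) * h| ≤ 2 * M := by
    rw [abs_mul]
    exact mul_le_mul ((abs_add_le a b).trans (by linarith)) hh (abs_nonneg _) (by norm_num)
  have h2 : |2 * c * k| ≤ 2 * M := by
    rw [abs_mul, abs_mul]
    refine mul_le_mul ?_ hk (abs_nonneg _) (by norm_num)
    rw [abs_two]; linarith
  exact (abs_sub _ _).trans (by linarith)

theorem algebra_contra {ux uy vx vy uxx uxy uyy vxx vxy vyy X Y E α M lam : ℝ}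
    (hu : ux ^ 2 + uy ^ 2 < 1) (hv : vx ^ 2 + vy ^ 2 < 1)
    (hueq : (1 - ux ^ 2) * uyy + 2 * ux * uy * uxy + (1 - uy ^ 2) * uxx = 0)
    (hveq : (1 - vx ^ 2) * vyy + 2 * vx * vy * vxy + (1 - vy ^ 2) * vxx = 0)
    (hE : 0 < E) (hα : 0 < α)
    (hwx : ux - vx = -2 * α * E * X) (hwy : uy - vy = -2 * α * E * Y)
    (h1 : 0 ≤ uxx - vxx - E * (4 * α ^ 2 * X ^ 2 - 2 * α))
    (h2 : 0 ≤ uyy - vyy - E * (4 * α ^ 2 * Y ^ 2 - 2 * α))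
    (h3 : 0 ≤ (ux ^ 2 * uxx + 2 * ux * uy * uxy + uy ^ 2 * uyy)
      - (ux ^ 2 * vxx + 2 * ux * uy * vxy + uy ^ 2 * vyy)
      - E * (4 * α ^ 2 * (X * ux + Y * uy) ^ 2 - 2 * α * (ux ^ 2 + uy ^ 2)))
    (hxx : |vxx| ≤ M) (hxy : |vxy| ≤ M) (hyy : |vyy| ≤ M)
    (hlam : lam ≤ 1 - ux ^ 2 - uy ^ 2)
    (hbig : 1 + 2 * M * (|X| + |Y|) < α * (lam * (X ^ 2 + Y ^ 2))) : False := by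
  obtain ⟨hux, huy⟩ := abs_le_one_of_sq hu
  obtain ⟨hvx, hvy⟩ := abs_le_one_of_sq hv
  have b1 := bracket_bound hux hvx huy hyy hxy
  have b2 := bracket_bound huy hvy hvx hxx hxy
  set B1 := (ux + vx) * vyy - 2 * uy * vxy with hB1
  set B2 := (uy + vy) * vxx - 2 * vx * vxy with hB2
  have hL : 0 < 1 - ux ^ 2 - uy ^ 2 := by linarith
  have hkey : (1 - uy ^ 2) * (uxx - vxx) + 2 * ux * uy * (uxy - vxy) + (1 - ux ^ 2) * (uyy - vyy)
      = (ux - vx) * B1 + (uy - vy) * B2 := by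
    rw [hB1, hB2]; linear_combination hueq - hveq
  have hXB : -(X * B1) ≤ |X| * (4 * M) := by
    refine (neg_le_abs _).trans ?_
    rw [abs_mul]; gcongr
  have hYB : -(Y * B2) ≤ |Y| * (4 * M) := by
    refine (neg_le_abs _).trans ?_
    rw [abs_mul]; gcongr
  have hlow := add_nonneg (mul_nonneg hL.le (add_nonneg h1 h2)) h3
  have hlow2 : E * (4 * α ^ 2 * ((1 - ux ^ 2 - uy ^ 2) * (X ^ 2 + Y ^ 2) + (X * ux + Y * uy) ^ 2)
      - 2 * α * (2 - ux ^ 2 - uy ^ 2)) ≤ (ux - vx) * B1 + (uy - vy) * B2 := by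
    rw [← hkey]; linarith
  rw [hwx, hwy] at hlow2
  have hEα : 0 < 2 * α * E := by positivity
  have h5 : (2 * α * E) * (2 * α * ((1 - ux ^ 2 - uy ^ 2) * (X ^ 2 + Y ^ 2)
      + (X * ux + Y * uy) ^ 2) - (2 - ux ^ 2 - uy ^ 2)) ≤ (2 * α * E) * (-(X * B1) + -(Y * B2)) := by
    linarith
  have h6 := le_of_mul_le_mul_left h5 hEα
  have h7 : α * (lam * (X ^ 2 + Y ^ 2)) ≤ α * ((1 - ux ^ 2 - uy ^ 2) * (X ^ 2 + Y ^ 2)) := by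
    gcongr
  have h8 : 0 ≤ α * (X * ux + Y * uy) ^ 2 := by positivity
  nlinarith [sq_nonneg ux, sq_nonneg uy]

theorem touch_contra {u v : ℝ × ℝ → ℝ} {y q : ℝ × ℝ} {ε α k M lam : ℝ}
    (hu : ContDiffAt ℝ 2 u y) (hv : ContDiffAt ℝ 2 v y)
    (hus : (pdx u y) ^ 2 + (pdy u y) ^ 2 < 1) (hvs : (pdx v y) ^ 2 + (pdy v y) ^ 2 < 1)
    (hueq : (1 - (pdx u y) ^ 2) * pdy (pdy u) y
      + 2 * pdx u y * pdy u y * pdy (pdx u) y + (1 - (pdy u y) ^ 2) * pdx (pdx u) y = 0)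
    (hveq : (1 - (pdx v y) ^ 2) * pdy (pdy v) y
      + 2 * pdx v y * pdy v y * pdy (pdx v) y + (1 - (pdy v y) ^ 2) * pdx (pdx v) y = 0)
    (hε : 0 < ε) (hα : 0 < α)
    (hmin : IsLocalMin (fun x => (u x - v x) - bar ε α k q x) y)
    (hxx : |hess v y (1, 0) (1, 0)| ≤ M) (hxy : |hess v y (0, 1) (1, 0)| ≤ M)
    (hyy : |hess v y (0, 1) (0, 1)| ≤ M)
    (hlam : lam ≤ 1 - (pdx u y) ^ 2 - (pdy u y) ^ 2)
    (hbig : 1 + 2 * M * (|y.1 - q.1| + |y.2 - q.2|)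
      < α * (lam * ((y.1 - q.1) ^ 2 + (y.2 - q.2) ^ 2))) : False := by
  have e1 : ∀ f, ContDiffAt ℝ 2 f y → pdx (pdx f) y = hess f y (1, 0) (1, 0) :=
    fun f hf => fderiv_dir hf _ _
  have e2 : ∀ f, ContDiffAt ℝ 2 f y → pdy (pdx f) y = hess f y (0, 1) (1, 0) :=
    fun f hf => fderiv_dir hf _ _
  have e3 : ∀ f, ContDiffAt ℝ 2 f y → pdy (pdy f) y = hess f y (0, 1) (0, 1) :=
    fun f hf => fderiv_dir hf _ _
  rw [e1 u hu, e2 u hu, e3 u hu] at hueq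
  rw [e1 v hv, e2 v hv, e3 v hv] at hveq
  have hb : ContDiffAt ℝ 2 (bar ε α k q) y := (bar_contDiff ε α k q).contDiffAt
  have hw : ContDiffAt ℝ 2 (fun x => u x - v x) y := hu.sub hv
  have hφ : ContDiffAt ℝ 2 (fun x => (u x - v x) - bar ε α k q x) y := hw.sub hb
  have hg := hmin.fderiv_eq_zero
  have d2 : ∀ f : ℝ × ℝ → ℝ, ContDiffAt ℝ 2 f y → DifferentiableAt ℝ f y :=
    fun f hf => hf.differentiableAt (by norm_num)
  rw [fderiv_fun_sub (d2 _ hw) (d2 _ hb), fderiv_fun_sub (d2 _ hu) (d2 _ hv)] at hg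
  have hg1 := congrArg (fun L : ℝ × ℝ →L[ℝ] ℝ => L (1, 0)) hg
  have hg2 := congrArg (fun L : ℝ × ℝ →L[ℝ] ℝ => L (0, 1)) hg
  simp only [sub_apply, zero_apply, bar_fderiv] at hg1 hg2
  have hH : ∀ d, 0 ≤ hess u y d d - hess v y d d - hess (bar ε α k q) y d d := by
    intro d
    have := hess_nonneg hφ hmin d
    rwa [hess_sub hw hb, hess_sub hu hv] at this
  have h1 := hH (1, 0)
  have h2 := hH (0, 1)
  have h3 := hH (pdx u y, pdy u y)
  rw [bar_hess] at h1 h2 h3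
  rw [hess_expand hu, hess_expand hv] at h3
  refine algebra_contra (E := ε * Real.exp (-α * ((y.1 - q.1) ^ 2 + (y.2 - q.2) ^ 2)))
    hus hvs hueq hveq (by positivity) hα (X := y.1 - q.1) (Y := y.2 - q.2) ?_ ?_ ?_ ?_ ?_
    hxx hxy hyy hlam hbig
  · unfold pdx; linarith
  · unfold pdy; linarith
  · simp only at h1; linarith
  · simp only at h2; linarith
  · simp only at h3; linarith

theorem exists_pos_lower {S : Set (ℝ × ℝ)} (hS : IsCompact S) {f : ℝ × ℝ → ℝ}
    (hf : ContinuousOn f S) (hpos : ∀ x ∈ S, 0 < f x) : ∃ m > 0, ∀ x ∈ S, m ≤ f x := by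
  rcases S.eq_empty_or_nonempty with rfl | hne
  · exact ⟨1, one_pos, by simp⟩
  · obtain ⟨x, hx, hm⟩ := hS.exists_isMinOn hne hf
    exact ⟨f x, hpos x hx, fun y hy => hm hy⟩

theorem local_contra {Ω : Set (ℝ × ℝ)} (hΩ : IsOpen Ω) {u v : ℝ × ℝ → ℝ}
    (hu : ContDiffOn ℝ 2 u Ω) (hv : ContDiffOn ℝ 2 v Ω)
    (huspace : ∀ p ∈ Ω, (pdx u p) ^ 2 + (pdy u p) ^ 2 < 1)
    (hvspace : ∀ p ∈ Ω, (pdx v p) ^ 2 + (pdy v p) ^ 2 < 1)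
    (hueq : ∀ p ∈ Ω, (1 - (pdx u p) ^ 2) * pdy (pdy u) p
      + 2 * pdx u p * pdy u p * pdy (pdx u) p
      + (1 - (pdy u p) ^ 2) * pdx (pdx u) p = 0)
    (hveq : ∀ p ∈ Ω, (1 - (pdx v p) ^ 2) * pdy (pdy v) p
      + 2 * pdx v p * pdy v p * pdy (pdx v) p
      + (1 - (pdy v p) ^ 2) * pdx (pdx v) p = 0)
    (hle : ∀ p ∈ Ω, v p ≤ u p)
    {z q : ℝ × ℝ} (hz : z ∈ Ω) (heq : u z = v z) {N : ℝ} (hN : 0 < N)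
    (hzN : (z.1 - q.1) ^ 2 + (z.2 - q.2) ^ 2 = N)
    (hball : ∀ᶠ x in 𝓝 z, (x.1 - q.1) ^ 2 + (x.2 - q.2) ^ 2 ≤ N → x ≠ z → v x < u x) : False := by
  have hcu : ∀ x ∈ Ω, ContDiffAt ℝ 2 u x := fun x hx => hu.contDiffAt (hΩ.mem_nhds hx)
  have hcv : ∀ x ∈ Ω, ContDiffAt ℝ 2 v x := fun x hx => hv.contDiffAt (hΩ.mem_nhds hx)
  obtain ⟨M, hM1, hM2, hM3⟩ : ∃ M, |hess v z (1, 0) (1, 0)| < M ∧ |hess v z (0, 1) (1, 0)| < M ∧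
      |hess v z (0, 1) (0, 1)| < M :=
    ⟨|hess v z (1, 0) (1, 0)| + |hess v z (0, 1) (1, 0)| + |hess v z (0, 1) (0, 1)| + 1,
      by linarith [abs_nonneg (hess v z (0, 1) (1, 0)), abs_nonneg (hess v z (0, 1) (0, 1))],
      by linarith [abs_nonneg (hess v z (1, 0) (1, 0)), abs_nonneg (hess v z (0, 1) (0, 1))],
      by linarith [abs_nonneg (hess v z (1, 0) (1, 0)), abs_nonneg (hess v z (0, 1) (1, 0))]⟩
  have hM : 0 < M := (abs_nonneg _).trans_lt hM1
  have hcd : ∀ e : ℝ × ℝ, ContinuousAt (fun x => fderiv ℝ u x e) z := fun e =>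
    (diffAt_fderiv (hcu z hz)).continuousAt.clm_apply continuousAt_const
  have hlamc : ContinuousAt (fun x => 1 - (pdx u x) ^ 2 - (pdy u x) ^ 2) z :=
    (continuousAt_const.sub ((hcd (1, 0)).pow 2)).sub ((hcd (0, 1)).pow 2)
  obtain ⟨lam, hlam0, hlam⟩ : ∃ lam, 0 < lam ∧ lam < 1 - (pdx u z) ^ 2 - (pdy u z) ^ 2 :=
    exists_between (by linarith [huspace z hz])
  set T := |z.1 - q.1| + |z.2 - q.2| + 1 with hT
  have hT0 : 0 < T := by positivity
  set α := 2 * (1 + 2 * M * T) / (lam * N) with hα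
  have hα0 : 0 < α := by positivity
  have hev : ∀ᶠ x in 𝓝 z, x ∈ Ω ∧ |hess v x (1, 0) (1, 0)| < M ∧ |hess v x (0, 1) (1, 0)| < M ∧
      |hess v x (0, 1) (0, 1)| < M ∧ lam < 1 - (pdx u x) ^ 2 - (pdy u x) ^ 2 ∧
      |x.1 - q.1| + |x.2 - q.2| < T ∧ N / 2 < (x.1 - q.1) ^ 2 + (x.2 - q.2) ^ 2 ∧
      ((x.1 - q.1) ^ 2 + (x.2 - q.2) ^ 2 ≤ N → x ≠ z → v x < u x) := by
    refine (hΩ.eventually_mem hz).and ?_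
    refine ((hess_cont (hcv z hz) _ _).abs.eventually_lt_const hM1).and ?_
    refine ((hess_cont (hcv z hz) _ _).abs.eventually_lt_const hM2).and ?_
    refine ((hess_cont (hcv z hz) _ _).abs.eventually_lt_const hM3).and ?_
    refine (hlamc.eventually_const_lt hlam).and ?_
    refine Eventually.and ?_ (Eventually.and ?_ hball)
    · have : ContinuousAt (fun x : ℝ × ℝ => |x.1 - q.1| + |x.2 - q.2|) z := by fun_prop
      exact this.eventually_lt_const (by linarith)
    · have : ContinuousAt (fun x : ℝ × ℝ => (x.1 - q.1) ^ 2 + (x.2 - q.2) ^ 2) z := by fun_prop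
      exact this.eventually_const_lt (by beta_reduce; rw [hzN]; linarith)
  obtain ⟨δ, hδ, hδs⟩ := Metric.nhds_basis_closedBall.eventually_iff.1 hev
  have hsubΩ : Metric.closedBall z δ ⊆ Ω := fun x hx => (hδs hx).1
  have hwc : ContinuousOn (fun x => u x - v x) (Metric.closedBall z δ) :=
    (hu.continuousOn.sub hv.continuousOn).mono hsubΩ
  have hScl : IsCompact (Metric.sphere z δ ∩ {x | (x.1 - q.1) ^ 2 + (x.2 - q.2) ^ 2 ≤ N}) := by
    refine (isCompact_sphere z δ).inter_right (isClosed_le ?_ continuous_const)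
    fun_prop
  obtain ⟨m, hm, hmS⟩ := exists_pos_lower hScl (f := fun x => u x - v x)
    (hwc.mono fun x hx => Metric.sphere_subset_closedBall hx.1) (by
      rintro x ⟨hx1, hx2⟩
      have hne : x ≠ z := by
        rintro rfl
        simp at hx1
        linarith
      have := (hδs (Metric.sphere_subset_closedBall hx1)).2.2.2.2.2.2.2 hx2 hne
      linarith)
  set k := Real.exp (-α * N) with hk
  have hk0 : 0 < k := Real.exp_pos _
  have hφc : ContinuousOn (fun x => (u x - v x) - bar m α k q x) (Metric.closedBall z δ) :=
    hwc.sub (bar_contDiff m α k q).continuous.continuousOn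
  obtain ⟨y, hy, hymin⟩ := (isCompact_closedBall z δ).exists_isMinOn
    ⟨z, Metric.mem_closedBall_self hδ.le⟩ hφc
  have hyz : (u y - v y) - bar m α k q y ≤ 0 := by
    have := hymin (Metric.mem_closedBall_self hδ.le)
    have hbz : bar m α k q z = 0 := by unfold bar; rw [hzN]; simp [hk]
    simp only [Set.mem_ofPred_eq, hbz, heq] at this
    linarith
  have hyint : y ∈ Metric.ball z δ := by
    by_contra hnot
    have hys : y ∈ Metric.sphere z δ := by
      simp only [Metric.mem_closedBall, Metric.mem_ball, not_lt, Metric.mem_sphere] at *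
      exact le_antisymm hy hnot
    by_cases hyN : (y.1 - q.1) ^ 2 + (y.2 - q.2) ^ 2 ≤ N
    · have h1 := hmS y ⟨hys, hyN⟩
      have h2 : Real.exp (-α * ((y.1 - q.1) ^ 2 + (y.2 - q.2) ^ 2)) ≤ 1 := by
        rw [Real.exp_le_one_iff]
        have : 0 ≤ α * ((y.1 - q.1) ^ 2 + (y.2 - q.2) ^ 2) := by positivity
        linarith
      have h3 : bar m α k q y < m := by unfold bar; nlinarith
      linarith
    · have h1 := hle y (hsubΩ hy)
      have h2 : Real.exp (-α * ((y.1 - q.1) ^ 2 + (y.2 - q.2) ^ 2)) < k := by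
        rw [hk, Real.exp_lt_exp]
        push Not at hyN
        nlinarith
      have h3 : bar m α k q y < 0 := by unfold bar; nlinarith
      linarith
  have hloc : IsLocalMin (fun x => (u x - v x) - bar m α k q x) y :=
    hymin.isLocalMin (Metric.closedBall_mem_nhds_of_mem hyint)
  obtain ⟨hyΩ, a1, a2, a3, a4, a5, a6, -⟩ := hδs hy
  refine touch_contra (hcu y hyΩ) (hcv y hyΩ) (huspace y hyΩ) (hvspace y hyΩ) (hueq y hyΩ)
    (hveq y hyΩ) hm hα0 hloc a1.le a2.le a3.le a4.le ?_
  have c1 : 1 + 2 * M * (|y.1 - q.1| + |y.2 - q.2|) < 1 + 2 * M * T := by gcongr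
  have c2 : α * (lam * (N / 2)) = 1 + 2 * M * T := by rw [hα]; field_simp
  have c3 : α * (lam * (N / 2)) < α * (lam * ((y.1 - q.1) ^ 2 + (y.2 - q.2) ^ 2)) := by gcongr
  linarith

/-- Interior strong maximum principle for the maximal surface equation: if `u, v` are
spacelike (`u_x² + u_y² < 1`) C² solutions of
`(1−u_x²)u_{yy} + 2u_x u_y u_{xy} + (1−u_y²)u_{xx} = 0` on an open set `Ω ⊆ ℝ²`,
with `u ≥ v` on `Ω` and `u(p) = v(p)` at some `p ∈ Ω`, then `u = v` on the connected
component of `Ω` containing `p`. -/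
theorem stmt5 (Ω : Set (ℝ × ℝ)) (hΩ : IsOpen Ω) (u v : ℝ × ℝ → ℝ)
    (hu : ContDiffOn ℝ 2 u Ω) (hv : ContDiffOn ℝ 2 v Ω)
    (huspace : ∀ p ∈ Ω, (pdx u p) ^ 2 + (pdy u p) ^ 2 < 1)
    (hvspace : ∀ p ∈ Ω, (pdx v p) ^ 2 + (pdy v p) ^ 2 < 1)
    (hueq : ∀ p ∈ Ω, (1 - (pdx u p) ^ 2) * pdy (pdy u) p
      + 2 * pdx u p * pdy u p * pdy (pdx u) p
      + (1 - (pdy u p) ^ 2) * pdx (pdx u) p = 0)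
    (hveq : ∀ p ∈ Ω, (1 - (pdx v p) ^ 2) * pdy (pdy v) p
      + 2 * pdx v p * pdy v p * pdy (pdx v) p
      + (1 - (pdy v p) ^ 2) * pdx (pdx v) p = 0)
    (hle : ∀ p ∈ Ω, v p ≤ u p)
    (p : ℝ × ℝ) (hp : p ∈ Ω) (heq : u p = v p) :
    ∀ q ∈ connectedComponentIn Ω p, u q = v q := by
  have hwc : ContinuousOn (fun x => u x - v x) Ω := hu.continuousOn.sub hv.continuousOn
  have hZ' : IsOpen (Ω ∩ (fun x => u x - v x) ⁻¹' {0}ᶜ) :=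
    hwc.isOpen_inter_preimage hΩ isOpen_compl_singleton
  have hZ : IsOpen {x | x ∈ Ω ∧ u x = v x} := by
    rw [isOpen_iff_mem_nhds]
    rintro a ⟨haΩ, ha⟩
    obtain ⟨R, hR, hRs⟩ := Metric.nhds_basis_closedBall.mem_iff.1 (hΩ.mem_nhds haΩ)
    refine Metric.mem_nhds_iff.2 ⟨R / 3, by positivity, fun c hc => ?_⟩
    have hcΩ : c ∈ Ω := hRs (Metric.closedBall_subset_closedBall (by linarith)
      (Metric.ball_subset_closedBall hc))
    refine ⟨hcΩ, ?_⟩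
    by_contra hne
    have hKc : IsCompact (Metric.closedBall a R ∩ (fun x => u x - v x) ⁻¹' {0}) := by
      refine (isCompact_closedBall a R).of_isClosed_subset ?_ Set.inter_subset_left
      exact (hwc.mono hRs).preimage_isClosed_of_isClosed Metric.isClosed_closedBall
        isClosed_singleton
    have haK : a ∈ Metric.closedBall a R ∩ (fun x => u x - v x) ⁻¹' {0} :=
      ⟨Metric.mem_closedBall_self hR.le, by simp [ha]⟩
    obtain ⟨z, ⟨hzK, hz0⟩, hzmin⟩ := hKc.exists_isMinOn ⟨a, haK⟩
      (f := fun x : ℝ × ℝ => (x.1 - c.1) ^ 2 + (x.2 - c.2) ^ 2) (by fun_prop)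
    have hz : u z = v z := by simpa [sub_eq_zero] using hz0
    have hza := hzmin haK
    simp only [Set.mem_ofPred_eq] at hza
    have hcd : |c.1 - a.1| < R / 3 ∧ |c.2 - a.2| < R / 3 := by
      simpa [Prod.dist_eq, Real.dist_eq] using hc
    obtain ⟨hc1, hc2⟩ := hcd
    rw [abs_lt] at hc1 hc2
    have hz1 : |z.1 - c.1| < 2 * (R / 3) := by
      apply abs_lt_of_sq_lt_sq _ (by positivity)
      nlinarith [sq_nonneg (z.2 - c.2)]
    have hz2 : |z.2 - c.2| < 2 * (R / 3) := by
      apply abs_lt_of_sq_lt_sq _ (by positivity)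
      nlinarith [sq_nonneg (z.1 - c.1)]
    rw [abs_lt] at hz1 hz2
    have hzb : z ∈ Metric.ball a R := by
      simp only [Metric.mem_ball, Prod.dist_eq, Real.dist_eq, max_lt_iff, abs_lt]
      refine ⟨⟨?_, ?_⟩, ?_, ?_⟩ <;> linarith
    have hzc : z ≠ c := by rintro rfl; exact hne hz
    have hN : 0 < ((z.1 - c.1) ^ 2 + (z.2 - c.2) ^ 2) / 4 := by
      have : z.1 - c.1 ≠ 0 ∨ z.2 - c.2 ≠ 0 := by
        by_contra h
        push Not at h
        exact hzc (Prod.ext (by linarith [h.1]) (by linarith [h.2]))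
      rcases this with h | h <;> positivity
    refine local_contra hΩ hu hv huspace hvspace hueq hveq hle (hRs hzK) hz
      (q := ((z.1 + c.1) / 2, (z.2 + c.2) / 2)) hN (by simp only; ring) ?_
    filter_upwards [Metric.isOpen_ball.mem_nhds hzb] with x hx hxN hxz
    have hxK := Metric.ball_subset_closedBall hx
    refine lt_of_le_of_ne (hle x (hRs hxK)) fun hxe => hxz ?_
    have hxm := hzmin (show x ∈ Metric.closedBall a R ∩ (fun x => u x - v x) ⁻¹' {0} from
      ⟨hxK, by simp [hxe]⟩)
    simp only [Set.mem_ofPred_eq] at hxm hxN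
    have hs : (x.1 - z.1) ^ 2 + (x.2 - z.2) ^ 2 ≤ 0 := by nlinarith
    have s1 : (x.1 - z.1) ^ 2 = 0 := by nlinarith [sq_nonneg (x.1 - z.1), sq_nonneg (x.2 - z.2)]
    have s2 : (x.2 - z.2) ^ 2 = 0 := by nlinarith [sq_nonneg (x.1 - z.1), sq_nonneg (x.2 - z.2)]
    rw [sq_eq_zero_iff] at s1 s2
    exact Prod.ext (by linarith) (by linarith)
  have hsub := isPreconnected_connectedComponentIn.subset_left_of_subset_union
    (s := connectedComponentIn Ω p) hZ hZ' (by
      rw [Set.disjoint_left]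
      rintro x ⟨_, h⟩ ⟨_, h'⟩
      exact h' (by simp [h])) (by
      intro x hx
      have hxΩ := connectedComponentIn_subset Ω p hx
      by_cases h : u x = v x
      · exact Or.inl ⟨hxΩ, h⟩
      · exact Or.inr ⟨hxΩ, by simpa [sub_eq_zero] using h⟩)
    ⟨p, mem_connectedComponentIn hp, hp, heq⟩
  intro q hq
  exact (hsub hq).2
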